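/- In the polynomial ring R with variables Z₀,…,Z_m (m ≥ 2) and (A_μ)_{|μ|=l}, let F = Σ_{|μ|=l} A_μ Z^μ and, for fixed complex constants (b_μ)_{|μ|=l}, let G = Σ_{|μ|=l} b_μ A_μ. Fix multi-indices λ, λ⁰ with |λ| = |λ⁰| = l−1 and indices 0 ≤ i < j ≤ m, and let e_i denote the i-th unit multi-index. Define the derivation W = (Z₂·b_{λ⁰+e₁} − Z₁·b_{λ⁰+e₂})·(Z_i·∂/∂A_{λ+e_j} − Z_j·∂/∂A_{λ+e_i}) + (Z_j·b_{λ+e_i} − Z_i·b_{λ+e_j})·(Z₂·∂/∂A_{λ⁰+e₁} − Z₁·∂/∂A_{λ⁰+e₂}). Then W(F) = 0 and W(G) = 0. (This is the cleared-denominator form of the second family of meromorphic vector fields constructed in the proof of the generalization of Clemens' theorem, expressing tangency to the universal hypersurface 𝔛.) -/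

import Mathlib

open MvPolynomial

/-- A monomial in the `inl` variables is constant with respect to the `inr` variables. -/
theorem pderiv_inr_prod_X_inl_pow {R σ τ : Type*} [CommSemiring R] [Fintype σ]
    (ν : τ) (μ : σ → ℕ) :
    pderiv (Sum.inr ν) (∏ i, (X (Sum.inl i) : MvPolynomial (σ ⊕ τ) R) ^ μ i) = 0 := by
  refine Finset.prod_induction _ (fun p => pderiv (Sum.inr ν) p = 0) ?_ (by simp) ?_
  · intro p q hp hq
    simp [hp, hq]
  · intro i _
    simp [pderiv_X_of_ne]

/-- The derivative of `∑ X (f μ) * c μ` along `f ν` is `c ν` if the `c μ` do not involve `f ν`. -/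
theorem pderiv_sum_X_mul {R σ τ : Type*} [CommSemiring R] {f : τ → σ}
    (hf : Function.Injective f) (s : Finset τ) (c : τ → MvPolynomial σ R) {ν : τ} (hν : ν ∈ s)
    (hc : ∀ μ ∈ s, pderiv (f ν) (c μ) = 0) :
    pderiv (f ν) (∑ μ ∈ s, X (f μ) * c μ) = c ν := by
  rw [map_sum, Finset.sum_eq_single_of_mem ν hν]
  · simp [hc ν hν]
  · intro μ hμ hne
    simp [hc μ hμ, pderiv_X_of_ne (hf.ne hne)]

/-- Raising one exponent of a monomial multiplies it by the corresponding variable. -/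
theorem prod_pow_add_single {M ι : Type*} [CommMonoid M] [Fintype ι] [DecidableEq ι]
    (x : ι → M) (κ : ι → ℕ) (k : ι) :
    ∏ t, x t ^ (κ + Pi.single k 1 : ι → ℕ) t = (∏ t, x t ^ κ t) * x k := by
  simp only [Pi.add_apply, pow_add, Finset.prod_mul_distrib]
  congr 1
  rw [Finset.prod_eq_single k] <;> simp +contextual

/-- the second family of (cleared-denominator) meromorphic vector
fields annihilates both `F = Σ_{|μ|=l} A_μ Z^μ` and `G = Σ_{|μ|=l} b_μ A_μ`. -/
theorem second_vector_fields_tangent_to_universal_hypersurface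
    (m l : ℕ) (hm : 2 ≤ m) (hl : 1 ≤ l)
    (b : (Fin (m + 1) → ℕ) → ℂ)
    (F G : MvPolynomial (Fin (m + 1) ⊕ (Fin (m + 1) → ℕ)) ℂ)
    (hF : F = ∑ μ ∈ Finset.Nat.antidiagonalTuple (m + 1) l,
        X (Sum.inr μ) * ∏ i : Fin (m + 1), X (Sum.inl i) ^ μ i)
    (hG : G = ∑ μ ∈ Finset.Nat.antidiagonalTuple (m + 1) l,
        C (b μ) * X (Sum.inr μ))
    (lam lam0 : Fin (m + 1) → ℕ)
    (hlam : (∑ i : Fin (m + 1), lam i) = l - 1)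
    (hlam0 : (∑ i : Fin (m + 1), lam0 i) = l - 1)
    (i j : Fin (m + 1)) (hij : i < j)
    (W : MvPolynomial (Fin (m + 1) ⊕ (Fin (m + 1) → ℕ)) ℂ →
        MvPolynomial (Fin (m + 1) ⊕ (Fin (m + 1) → ℕ)) ℂ)
    (hW : ∀ H : MvPolynomial (Fin (m + 1) ⊕ (Fin (m + 1) → ℕ)) ℂ,
        W H =
          (X (Sum.inl (2 : Fin (m + 1))) * C (b (lam0 + Pi.single (1 : Fin (m + 1)) 1))
              - X (Sum.inl (1 : Fin (m + 1))) * C (b (lam0 + Pi.single (2 : Fin (m + 1)) 1))) *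
            (X (Sum.inl i) * pderiv (Sum.inr (lam + Pi.single j 1)) H
              - X (Sum.inl j) * pderiv (Sum.inr (lam + Pi.single i 1)) H)
          + (X (Sum.inl j) * C (b (lam + Pi.single i 1))
              - X (Sum.inl i) * C (b (lam + Pi.single j 1))) *
            (X (Sum.inl (2 : Fin (m + 1))) * pderiv (Sum.inr (lam0 + Pi.single (1 : Fin (m + 1)) 1)) H
              - X (Sum.inl (1 : Fin (m + 1))) * pderiv (Sum.inr (lam0 + Pi.single (2 : Fin (m + 1)) 1)) H)) :
    W F = 0 ∧ W G = 0 := by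
  have mem : ∀ κ : Fin (m + 1) → ℕ, ∑ t, κ t = l - 1 → ∀ k,
      κ + Pi.single k 1 ∈ Finset.Nat.antidiagonalTuple (m + 1) l := by
    intro κ hκ k
    rw [Finset.Nat.mem_antidiagonalTuple]
    simp only [Pi.add_apply, Finset.sum_add_distrib, hκ, Finset.sum_pi_single', Finset.mem_univ,
      if_true]
    omega
  have hdF : ∀ κ : Fin (m + 1) → ℕ, ∑ t, κ t = l - 1 → ∀ k,
      pderiv (Sum.inr (κ + Pi.single k 1)) F = (∏ t, X (Sum.inl t) ^ κ t) * X (Sum.inl k) := by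
    intro κ hκ k
    rw [hF, pderiv_sum_X_mul Sum.inr_injective _ _ (mem κ hκ k)
      fun μ _ => pderiv_inr_prod_X_inl_pow _ μ]
    exact prod_pow_add_single _ κ k
  have hdG : ∀ κ : Fin (m + 1) → ℕ, ∑ t, κ t = l - 1 → ∀ k,
      pderiv (Sum.inr (κ + Pi.single k 1)) G = C (b (κ + Pi.single k 1)) := by
    intro κ hκ k
    simp only [hG, mul_comm (C _)]
    exact pderiv_sum_X_mul Sum.inr_injective _ (fun μ => C (b μ)) (mem κ hκ k)
      fun μ _ => pderiv_C
  constructor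
  · rw [hW, hdF lam hlam, hdF lam hlam, hdF lam0 hlam0, hdF lam0 hlam0]
    ring
  · rw [hW, hdG lam hlam, hdG lam hlam, hdG lam0 hlam0, hdG lam0 hlam0]
    ring
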